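/- The family {vJ⁺(a,b) : (a,b) ∈ ℤ², a ≥ b} ∪ {vJᴬ(a,b) : (a,b) ∈ ℤ², a ≥ b} ∪ {vS(a) : a ∈ ℤ} ∪ {Y_{−1} + Y₁, X_{0,0} + Y_{−2} + Y₀ + Y₂} is linearly independent in V, and its ℚ-linear span equals the subspace {v ∈ V : ψ₃(v) = ψ₄(v) = ψ₅(v) = ψ₆(v) = 0}. -/

import Mathlib

noncomputable section

abbrev Xsp : Type := (ℤ × ℤ) →₀ ℚ
abbrev Ysp : Type := ℤ →₀ ℚ
abbrev V : Type := Xsp × Ysp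

/-- The basis vector `X_{a,b}` of `V`. -/
def XB (a b : ℤ) : V := (Finsupp.single (a, b) 1, 0)

/-- The basis vector `Y_d` of `V`. -/
def YB (d : ℤ) : V := (0, Finsupp.single d 1)

/-- The linear map `V → ℚ` determined on the basis by `X_{a,b} ↦ gX (a,b)`, `Y_d ↦ gY d`. -/
def lmap (gX : ℤ × ℤ → ℚ) (gY : ℤ → ℚ) : V →ₗ[ℚ] ℚ :=
  (Finsupp.linearCombination ℚ gX).comp (LinearMap.fst ℚ Xsp Ysp)
  + (Finsupp.linearCombination ℚ gY).comp (LinearMap.snd ℚ Xsp Ysp)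

/-- `ψ₁ : Y_d ↦ 1` for `d` odd, `X_{a,b} ↦ -1` for `a+b` odd, all else to `0`. -/
def psi1 : V →ₗ[ℚ] ℚ :=
  lmap (fun p => if Odd (p.1 + p.2) then -1 else 0) (fun d => if Odd d then 1 else 0)

/-- `ψ₂ : Y_d ↦ 1` for `d` even, `X_{a,b} ↦ -1` for `a+b` even, all else to `0`. -/
def psi2 : V →ₗ[ℚ] ℚ :=
  lmap (fun p => if Even (p.1 + p.2) then -1 else 0) (fun d => if Even d then 1 else 0)

/-- `ψ₃ : Y_d ↦ d` for `d` odd, `X_{a,b} ↦ -(a+b)` for `a+b` odd, all else to `0`. -/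
def psi3 : V →ₗ[ℚ] ℚ :=
  lmap (fun p => if Odd (p.1 + p.2) then -((p.1 : ℚ) + p.2) else 0)
    (fun d => if Odd d then (d : ℚ) else 0)

/-- `ψ₄ : Y_d ↦ d` for `d` even, `X_{a,b} ↦ -(a+b)` for `a+b` even, all else to `0`. -/
def psi4 : V →ₗ[ℚ] ℚ :=
  lmap (fun p => if Even (p.1 + p.2) then -((p.1 : ℚ) + p.2) else 0)
    (fun d => if Even d then (d : ℚ) else 0)

/-- `ψ₅ : Y_d ↦ 1/d` for `d` odd,
`X_{a,b} ↦ (4(a-b+1) - (a+b)²)/((a+b)((a+b)²-4))` for `a+b` odd, all else to `0`. -/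
def psi5 : V →ₗ[ℚ] ℚ :=
  lmap
    (fun p => if Odd (p.1 + p.2) then
        (4 * ((p.1 : ℚ) - p.2 + 1) - ((p.1 : ℚ) + p.2) ^ 2) /
          (((p.1 : ℚ) + p.2) * (((p.1 : ℚ) + p.2) ^ 2 - 4))
      else 0)
    (fun d => if Odd d then 1 / (d : ℚ) else 0)

/-- `ψ₆ : Y₀ ↦ 1`, `X_{a,b} ↦ b-a-1` for `a+b = 0`, `X_{a,b} ↦ (a-b)/2` for `a+b = ±2`,
all else to `0`. -/
def psi6 : V →ₗ[ℚ] ℚ :=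
  lmap
    (fun p => if p.1 + p.2 = 0 then (p.2 : ℚ) - p.1 - 1
      else if p.1 + p.2 = 2 ∨ p.1 + p.2 = -2 then ((p.1 : ℚ) - p.2) / 2 else 0)
    (fun d => if d = 0 then 1 else 0)

/-- The six linear maps `ψ₁, …, ψ₆`. -/
def psi : Fin 6 → (V →ₗ[ℚ] ℚ) := ![psi1, psi2, psi3, psi4, psi5, psi6]

/-- `vJ⁺(a,b) = X_{a,b} + X_{b,a} + 2·Y_{a+b}`, the value `F⁽¹⁾(J⁺_{a,b})`. -/
def vJp (a b : ℤ) : V := XB a b + XB b a + (2 : ℚ) • YB (a + b)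

/-- `vJᴬ(a,b) = X_{a,b+1} + X_{b,a+1} + Y_{a+b-1} + Y_{a+b+3}`, the value `F⁽¹⁾(J^A_{a,b})`. -/
def vJA (a b : ℤ) : V := XB a (b + 1) + XB b (a + 1) + YB (a + b - 1) + YB (a + b + 3)

/-- `vS(a) = -2·X_{0,a+1} - X_{-1,a} + X_{1,a} + 2·X_{0,a-1} - Y_{a+1} + Y_{a-1}`,
the `Z`-part of `F⁽¹⁾(S_{â,0,0})`. -/
def vS (a : ℤ) : V :=
  -((2 : ℚ) • XB 0 (a + 1)) - XB (-1) a + XB 1 a + (2 : ℚ) • XB 0 (a - 1)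
    - YB (a + 1) + YB (a - 1)

/-- A family is linearly independent if it is triangular, with respect to some ranking of the
indices, against a family of linear functionals. -/
theorem linearIndependent_of_triangular_dual {K M ι α : Type*} [Field K] [AddCommGroup M]
    [Module K M] [LinearOrder α] (v : ι → M) (r : ι → α)
    (h : ∀ i, ∃ φ : M →ₗ[K] K, φ (v i) ≠ 0 ∧ ∀ j, j ≠ i → r j ≤ r i → φ (v j) = 0) :
    LinearIndependent K v := by
  rw [linearIndependent_iff]
  intro l hl
  by_contra hne
  obtain ⟨i, hi, hmax⟩ := l.support.exists_max_image r (Finsupp.support_nonempty_iff.mpr hne)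
  obtain ⟨φ, hφi, hφ⟩ := h i
  have key : φ (Finsupp.linearCombination K v l) = l i * φ (v i) := by
    rw [Finsupp.linearCombination_apply, Finsupp.sum, map_sum, Finset.sum_eq_single i]
    · simp
    · intro j hj hji
      simp [hφ j hji (hmax j hj)]
    · intro hi'
      exact absurd hi hi'
  rw [hl, map_zero] at key
  exact mul_ne_zero (Finsupp.mem_support_iff.mp hi) hφi key.symm

/-- A sequence over `ℤ` whose third differences lie in a submodule, as do three consecutive terms,
lies entirely in the submodule. -/
theorem mem_of_third_difference_mem {K M : Type*} [Ring K] [AddCommGroup M] [Module K M]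
    (S : Submodule K M) (u : ℤ → M)
    (hu : ∀ n, u (n + 3) - (3 : ℤ) • u (n + 2) + (3 : ℤ) • u (n + 1) - u n ∈ S)
    (h0 : u 0 ∈ S) (h1 : u 1 ∈ S) (h2 : u 2 ∈ S) (n : ℤ) : u n ∈ S := by
  suffices h : u n ∈ S ∧ u (n + 1) ∈ S ∧ u (n + 2) ∈ S from h.1
  induction n using Int.induction_on with
  | zero => exact ⟨h0, by simpa using h1, by simpa using h2⟩
  | succ i ih =>
    obtain ⟨ha, hb, hc⟩ := ih
    have e1 : (i : ℤ) + 1 + 1 = i + 2 := by ring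
    have e2 : (i : ℤ) + 1 + 2 = i + 3 := by ring
    refine ⟨hb, e1 ▸ hc, e2 ▸ ?_⟩
    have := S.add_mem (S.add_mem (S.sub_mem (hu i) (S.smul_of_tower_mem (3 : ℤ) hb)) ha)
      (S.smul_of_tower_mem (3 : ℤ) hc)
    convert this using 1
    abel
  | pred i ih =>
    obtain ⟨ha, hb, hc⟩ := ih
    have e0 : -(i : ℤ) - 1 + 1 = -i := by ring
    have e1 : -(i : ℤ) - 1 + 2 = -i + 1 := by ring
    have e2 : -(i : ℤ) - 1 + 3 = -i + 2 := by ring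
    refine ⟨?_, by rwa [e0], by rwa [e1]⟩
    have h := hu (-(i : ℤ) - 1)
    rw [e0, e1, e2] at h
    have := S.sub_mem (S.add_mem (S.sub_mem hc (S.smul_of_tower_mem (3 : ℤ) hb))
      (S.smul_of_tower_mem (3 : ℤ) ha)) h
    convert this using 1
    abel

@[simp] theorem lmap_XB (gX : ℤ × ℤ → ℚ) (gY : ℤ → ℚ) (a b : ℤ) :
    lmap gX gY (XB a b) = gX (a, b) := by
  simp [lmap, XB]

@[simp] theorem lmap_YB (gX : ℤ × ℤ → ℚ) (gY : ℤ → ℚ) (d : ℤ) :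
    lmap gX gY (YB d) = gY d := by
  simp [lmap, YB]

theorem span_XB_YB_eq_top :
    Submodule.span ℚ (Set.range (fun p : ℤ × ℤ => XB p.1 p.2) ∪ Set.range YB) = ⊤ := by
  rw [eq_top_iff]
  rintro ⟨x, y⟩ -
  have hx : ((x, 0) : V) ∈
      Submodule.span ℚ (Set.range (fun p : ℤ × ℤ => XB p.1 p.2) ∪ Set.range YB) := by
    induction x using Finsupp.induction_linear with
    | zero => exact Submodule.zero_mem _
    | add f g hf hg => simpa using Submodule.add_mem _ hf hg
    | single p c =>
      have : ((Finsupp.single p c, 0) : V) = c • XB p.1 p.2 := by simp [XB]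
      rw [this]
      exact Submodule.smul_mem _ _ (Submodule.subset_span (Or.inl ⟨p, rfl⟩))
  have hy : ((0, y) : V) ∈
      Submodule.span ℚ (Set.range (fun p : ℤ × ℤ => XB p.1 p.2) ∪ Set.range YB) := by
    induction y using Finsupp.induction_linear with
    | zero => exact Submodule.zero_mem _
    | add f g hf hg => simpa using Submodule.add_mem _ hf hg
    | single d c =>
      have : ((0, Finsupp.single d c) : V) = c • YB d := by simp [YB]
      rw [this]
      exact Submodule.smul_mem _ _ (Submodule.subset_span (Or.inr ⟨d, rfl⟩))
  simpa using Submodule.add_mem _ hx hy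

theorem vJp_comm (a b : ℤ) : vJp a b = vJp b a := by
  simp only [vJp, add_comm b a]
  abel

theorem vJA_comm (a b : ℤ) : vJA a b = vJA b a := by
  simp only [vJA, add_comm b a]
  abel

/-- The extension to `V` of a functional on `Y` that kills all `vJp a b` and `vJA a b`. -/
def extendY (f : ℤ → ℚ) : V →ₗ[ℚ] ℚ :=
  lmap (fun p => -f (p.1 + p.2) + ((p.1 : ℚ) - p.2) / 2 *
    (f (p.1 + p.2 - 2) - 2 * f (p.1 + p.2) + f (p.1 + p.2 + 2))) f

theorem extendY_vJp (f : ℤ → ℚ) (a b : ℤ) : extendY f (vJp a b) = 0 := by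
  simp only [extendY, vJp, map_add, map_smul, lmap_XB, lmap_YB, smul_eq_mul, add_comm b a]
  ring

theorem extendY_vJA (f : ℤ → ℚ) (a b : ℤ) : extendY f (vJA a b) = 0 := by
  have e1 : b + (a + 1) = a + b + 1 := by ring
  have e2 : a + (b + 1) = a + b + 1 := by ring
  have e3 : a + b + 1 - 2 = a + b - 1 := by ring
  have e4 : a + b + 1 + 2 = a + b + 3 := by ring
  simp only [extendY, vJA, map_add, lmap_XB, lmap_YB, e1, e2, e3, e4]
  push_cast
  ring

theorem extendY_vS (f : ℤ → ℚ) (a : ℤ) :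
    extendY f (vS a) = ((a + 3 : ℤ) * f (a + 3) - 3 * ((a + 1 : ℤ) * f (a + 1))
      + 3 * ((a - 1 : ℤ) * f (a - 1)) - (a - 3 : ℤ) * f (a - 3)) / 2 := by
  have e1 : -1 + a = a - 1 := by ring
  have e2 : 1 + a = a + 1 := by ring
  have e3 : a + 1 - 2 = a - 1 := by ring
  have e4 : a + 1 + 2 = a + 3 := by ring
  have e5 : a - 1 - 2 = a - 3 := by ring
  have e6 : a - 1 + 2 = a + 1 := by ring
  simp only [extendY, vS, map_add, map_sub, map_neg, map_smul, lmap_XB, lmap_YB, smul_eq_mul,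
    zero_add, e1, e2, e3, e4, e5, e6]
  push_cast
  ring

/-- There is a sequence that vanishes at `0`, takes the same values at `d` and `-d` for `d = 1, 2`,
and whose third difference with step `2` is the indicator of `a`. -/
theorem exists_third_difference_eq_indicator (a : ℤ) : ∃ g : ℤ → ℚ, g 0 = 0 ∧ g (-1) = g 1 ∧
    g (-2) = g 2 ∧ ∀ c, g (c + 3) - 3 * g (c + 1) + 3 * g (c - 1) - g (c - 3) =
      if c = a then 1 else 0 := by
  obtain ⟨h, hh⟩ : ∃ h : ℤ → ℚ, ∀ d, h d =
      if a ≤ d then ((d : ℚ) - a - 1) * (d - a + 1) / 8 else 0 := ⟨_, fun _ => rfl⟩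
  have hdiff : ∀ c : ℤ, Even (c - a) →
      h (c + 3) - 3 * h (c + 1) + 3 * h (c - 1) - h (c - 3) = if c = a then 1 else 0 := by
    rintro c ⟨k, hk⟩
    obtain rfl : c = a + (k + k) := by omega
    simp only [hh]
    rcases lt_trichotomy k 0 with hk0 | rfl | hk0
    · by_cases hk1 : k = -1
      · subst hk1
        rw [if_pos (by omega), if_neg (by omega), if_neg (by omega), if_neg (by omega),
          if_neg (by omega)]
        push_cast
        ring
      · rw [if_neg (by omega), if_neg (by omega), if_neg (by omega), if_neg (by omega),
          if_neg (by omega)]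
        ring
    · rw [if_pos (by omega), if_pos (by omega), if_neg (by omega), if_neg (by omega),
          if_pos (by omega)]
      push_cast
      ring
    · by_cases hk1 : k = 1
      · subst hk1
        rw [if_pos (by omega), if_pos (by omega), if_pos (by omega), if_neg (by omega),
          if_neg (by omega)]
        push_cast
        ring
      · rw [if_pos (by omega), if_pos (by omega), if_pos (by omega), if_pos (by omega),
          if_neg (by omega)]
        push_cast
        ring
  obtain ⟨β, hβ⟩ : ∃ β : ℚ, (Even a → h (-1) - β = h 1 + β) ∧
      (¬ Even a → h (-2) - 2 * β = h 2 + 2 * β) := by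
    by_cases ha : Even a
    · exact ⟨(h (-1) - h 1) / 2, fun _ => by ring, fun h => absurd ha h⟩
    · exact ⟨(h (-2) - h 2) / 4, fun h => absurd h ha, fun _ => by ring⟩
  refine ⟨fun d => if Even (d - a) then 0 else h d - h 0 + β * d, ?_, ?_, ?_, ?_⟩
  · simp
  · by_cases ha : Even a
    · have := hβ.1 ha
      simp [Int.even_sub, ha]
      linarith
    · simp [Int.even_sub, ha]
  · by_cases ha : Even a
    · simp [Int.even_sub, ha]
    · have := hβ.2 ha
      simp [Int.even_sub, ha]
      linarith
  · intro c
    have o : ∀ n : ℤ, Odd n → (Even (c + n - a) ↔ ¬ Even (c - a)) := by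
      intro n hn
      rw [show c + n - a = c - a + n by ring, Int.even_add, ← Int.not_odd_iff_even (n := n)]
      tauto
    have o1 := o 1 (by decide)
    have o3 := o 3 (by decide)
    have o1' := o (-1) (by decide)
    have o3' := o (-3) (by decide)
    rw [← sub_eq_add_neg] at o1' o3'
    simp only [o1, o3, o1', o3']
    by_cases hc : Even (c - a)
    · rw [← hdiff c hc]
      simp only [hc, not_true_eq_false, if_false]
      push_cast
      ring
    · have hca : c ≠ a := by
        rintro rfl
        simp at hc
      simp [hc, hca]

/-- The generator `F(Γ₀)`. -/
def vCircle : V := YB (-1) + YB 1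

/-- The generator `F(Γ₁)`. -/
def vEight : V := XB 0 0 + YB (-2) + YB 0 + YB 2

/-- The family of generators. -/
def genFamily : {p : ℤ × ℤ // p.2 ≤ p.1} ⊕ {p : ℤ × ℤ // p.2 ≤ p.1} ⊕ ℤ ⊕ Fin 2 → V :=
  Sum.elim (fun p => vJp p.1.1 p.1.2)
    (Sum.elim (fun p => vJA p.1.1 p.1.2) (Sum.elim vS ![vCircle, vEight]))

/-- The ranking of the generators for which they are triangular. -/
def genRank : {p : ℤ × ℤ // p.2 ≤ p.1} ⊕ {p : ℤ × ℤ // p.2 ≤ p.1} ⊕ ℤ ⊕ Fin 2 → WithTop ℤ :=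
  Sum.elim (fun p => ((2 * (p.1.1 - p.1.2) : ℤ) : WithTop ℤ))
    (Sum.elim (fun p => ((2 * (p.1.1 - p.1.2) + 1 : ℤ) : WithTop ℤ)) (fun _ => ⊤))

theorem exists_dual_vS (a : ℤ) : ∃ φ : V →ₗ[ℚ] ℚ, φ (vS a) ≠ 0 ∧ (∀ c, c ≠ a → φ (vS c) = 0) ∧
    φ vCircle = 0 ∧ φ vEight = 0 ∧ (∀ x y, φ (vJp x y) = 0) ∧ ∀ x y, φ (vJA x y) = 0 := by
  obtain ⟨g, g0, g1, g2, hg⟩ := exists_third_difference_eq_indicator a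
  have hf : ∀ d : ℤ, (d : ℚ) * (g d / d) = g d := by
    intro d
    by_cases hd : d = 0
    · simp [hd, g0]
    · have : (d : ℚ) ≠ 0 := by exact_mod_cast hd
      field_simp
  have hS : ∀ c, extendY (fun d => g d / d) (vS c) = (if c = a then 1 else 0) / 2 := by
    intro c
    rw [extendY_vS, ← hg c, hf, hf, hf, hf]
  refine ⟨extendY fun d => g d / d, by simp [hS], fun c hc => by simp [hS, hc], ?_, ?_,
    extendY_vJp _, extendY_vJA _⟩
  · simp [extendY, vCircle, g1]
    ring
  · simp [extendY, vEight, g2]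
    ring

theorem psi1_eq_extendY : psi1 = extendY fun d => if Odd d then 1 else 0 := by
  rw [psi1, extendY]
  congr 1
  ext ⟨a, b⟩
  have e1 : Odd (a + b - 2) ↔ Odd (a + b) := by simp
  have e2 : Odd (a + b + 2) ↔ Odd (a + b) := by simp [Int.odd_add]
  simp only [e1, e2]
  split_ifs <;> ring

theorem psi2_eq_extendY : psi2 = extendY fun d => if Even d then 1 else 0 := by
  rw [psi2, extendY]
  congr 1
  ext ⟨a, b⟩
  have e1 : Even (a + b - 2) ↔ Even (a + b) := by simp
  have e2 : Even (a + b + 2) ↔ Even (a + b) := by simp [Int.even_add]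
  simp only [e1, e2]
  split_ifs <;> ring

theorem psi3_eq_extendY : psi3 = extendY fun d => if Odd d then (d : ℚ) else 0 := by
  rw [psi3, extendY]
  congr 1
  ext ⟨a, b⟩
  have e1 : Odd (a + b - 2) ↔ Odd (a + b) := by simp
  have e2 : Odd (a + b + 2) ↔ Odd (a + b) := by simp [Int.odd_add]
  simp only [e1, e2]
  split_ifs <;> push_cast <;> ring

theorem psi4_eq_extendY : psi4 = extendY fun d => if Even d then (d : ℚ) else 0 := by
  rw [psi4, extendY]
  congr 1
  ext ⟨a, b⟩
  have e1 : Even (a + b - 2) ↔ Even (a + b) := by simp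
  have e2 : Even (a + b + 2) ↔ Even (a + b) := by simp [Int.even_add]
  simp only [e1, e2]
  split_ifs <;> push_cast <;> ring

theorem psi5_eq_extendY : psi5 = extendY fun d => if Odd d then 1 / (d : ℚ) else 0 := by
  rw [psi5, extendY]
  congr 1
  ext ⟨a, b⟩
  have e1 : Odd (a + b - 2) ↔ Odd (a + b) := by simp
  have e2 : Odd (a + b + 2) ↔ Odd (a + b) := by simp [Int.odd_add]
  simp only [e1, e2]
  split_ifs with h
  · obtain ⟨k, hk⟩ := h
    have h0 : (a : ℚ) + b ≠ 0 := by exact_mod_cast (by omega : a + b ≠ 0)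
    have h1 : (a : ℚ) + b - 2 ≠ 0 := by exact_mod_cast (by omega : a + b - 2 ≠ 0)
    have h2 : (a : ℚ) + b + 2 ≠ 0 := by exact_mod_cast (by omega : a + b + 2 ≠ 0)
    have h3 : ((a : ℚ) + b) ^ 2 - 4 = (a + b - 2) * (a + b + 2) := by ring
    push_cast
    rw [h3]
    field_simp
    ring
  · ring

theorem psi6_eq_extendY : psi6 = extendY fun d => if d = 0 then 1 else 0 := by
  rw [psi6, extendY]
  congr 1
  ext ⟨a, b⟩
  dsimp only
  split_ifs <;> first | omega | ring

theorem odd_add_odd_iff (a : ℤ) {n : ℤ} (hn : Odd n) : Odd (a + n) ↔ Even a := by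
  rw [Int.odd_add, ← Int.not_odd_iff_even, ← Int.not_odd_iff_even]
  tauto

theorem odd_sub_odd_iff (a : ℤ) {n : ℤ} (hn : Odd n) : Odd (a - n) ↔ Even a := by
  rw [sub_eq_add_neg, odd_add_odd_iff a hn.neg]

theorem psi1_vS (a : ℤ) : psi1 (vS a) = 0 := by
  rw [psi1_eq_extendY, extendY_vS]
  simp only [odd_add_odd_iff a (n := 3) (by decide), odd_add_odd_iff a odd_one,
    odd_sub_odd_iff a (n := 3) (by decide), odd_sub_odd_iff a odd_one]
  split_ifs <;> push_cast <;> ring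

theorem psi2_vS (a : ℤ) : psi2 (vS a) = 0 := by
  rw [psi2_eq_extendY, extendY_vS]
  simp only [← Int.not_odd_iff_even, odd_add_odd_iff a (n := 3) (by decide),
    odd_add_odd_iff a odd_one, odd_sub_odd_iff a (n := 3) (by decide), odd_sub_odd_iff a odd_one]
  split_ifs <;> push_cast <;> ring

theorem psi3_vS (a : ℤ) : psi3 (vS a) = 0 := by
  rw [psi3_eq_extendY, extendY_vS]
  simp only [odd_add_odd_iff a (n := 3) (by decide), odd_add_odd_iff a odd_one,
    odd_sub_odd_iff a (n := 3) (by decide), odd_sub_odd_iff a odd_one]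
  split_ifs <;> push_cast <;> ring

theorem psi4_vS (a : ℤ) : psi4 (vS a) = 0 := by
  rw [psi4_eq_extendY, extendY_vS]
  simp only [← Int.not_odd_iff_even, odd_add_odd_iff a (n := 3) (by decide),
    odd_add_odd_iff a odd_one, odd_sub_odd_iff a (n := 3) (by decide), odd_sub_odd_iff a odd_one]
  split_ifs <;> push_cast <;> ring

theorem psi5_vS (a : ℤ) : psi5 (vS a) = 0 := by
  have hf : ∀ d : ℤ, (d : ℚ) * (if Odd d then 1 / (d : ℚ) else 0) = if Odd d then 1 else 0 := by
    intro d
    split_ifs with hd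
    · have : (d : ℚ) ≠ 0 := by
        rintro h
        obtain rfl : d = 0 := by exact_mod_cast h
        simp at hd
      field_simp
    · ring
  rw [psi5_eq_extendY, extendY_vS, hf, hf, hf, hf]
  simp only [odd_add_odd_iff a (n := 3) (by decide), odd_add_odd_iff a odd_one,
    odd_sub_odd_iff a (n := 3) (by decide), odd_sub_odd_iff a odd_one]
  split_ifs <;> ring

theorem psi6_vS (a : ℤ) : psi6 (vS a) = 0 := by
  have hf : ∀ d : ℤ, (d : ℚ) * (if d = 0 then 1 else 0) = 0 := by simp
  rw [psi6_eq_extendY, extendY_vS, hf, hf, hf, hf]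
  ring

theorem psi1_vCircle : psi1 vCircle = 2 := by
  simp [psi1, vCircle, ← Int.not_even_iff_odd]
  norm_num

theorem psi2_vCircle : psi2 vCircle = 0 := by
  simp [psi2, vCircle]

theorem psi1_vEight : psi1 vEight = 0 := by
  simp [psi1, vEight, ← Int.not_even_iff_odd]

theorem psi2_vEight : psi2 vEight = 2 := by
  simp [psi2, vEight]
  norm_num

theorem linearIndependent_genFamily : LinearIndependent ℚ genFamily := by
  apply linearIndependent_of_triangular_dual genFamily genRank
  rintro (⟨⟨a, b⟩, hab⟩ | ⟨⟨a, b⟩, hab⟩ | a | i)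
  · refine ⟨lmap (fun p => if p = (a, b) then 1 else 0) 0, ?_, ?_⟩
    · simp only [genFamily, vJp, Sum.elim_inl, map_add, map_smul, lmap_XB, lmap_YB]
      split_ifs <;> simp
    · rintro (⟨⟨c, d⟩, hcd⟩ | ⟨⟨c, d⟩, hcd⟩ | c | j) hne hr
      · replace hr : 2 * (c - d) ≤ 2 * (a - b) := WithTop.coe_le_coe.mp hr
        simp at hne hab hcd
        simp [genFamily, vJp]
        grind
      · replace hr : 2 * (c - d) + 1 ≤ 2 * (a - b) := WithTop.coe_le_coe.mp hr
        simp at hab hcd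
        simp [genFamily, vJA]
        grind
      · exact absurd (top_le_iff.mp hr) (WithTop.coe_ne_top)
      · exact absurd (top_le_iff.mp hr) (WithTop.coe_ne_top)
  · refine ⟨lmap (fun p => if p = (b, a + 1) then 1 else 0) 0, ?_, ?_⟩
    · simp only [genFamily, vJA, Sum.elim_inl, Sum.elim_inr, map_add, lmap_XB, lmap_YB]
      split_ifs <;> simp
    · rintro (⟨⟨c, d⟩, hcd⟩ | ⟨⟨c, d⟩, hcd⟩ | c | j) hne hr
      · replace hr : 2 * (c - d) ≤ 2 * (a - b) + 1 := WithTop.coe_le_coe.mp hr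
        simp at hab hcd
        simp [genFamily, vJp]
        grind
      · replace hr : 2 * (c - d) + 1 ≤ 2 * (a - b) + 1 := WithTop.coe_le_coe.mp hr
        simp at hne hab hcd
        simp [genFamily, vJA]
        grind
      · exact absurd (top_le_iff.mp hr) (WithTop.coe_ne_top)
      · exact absurd (top_le_iff.mp hr) (WithTop.coe_ne_top)
  · obtain ⟨φ, h0, hS, hC, hE, hp, hA⟩ := exists_dual_vS a
    refine ⟨φ, h0, ?_⟩
    rintro (p | p | c | j) hne -
    · exact hp _ _
    · exact hA _ _
    · exact hS c (by simpa using hne)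
    · fin_cases j
      · exact hC
      · exact hE
  · fin_cases i
    · refine ⟨psi1, by simp [genFamily, psi1_vCircle], ?_⟩
      rintro (p | p | c | j) hne -
      · exact psi1_eq_extendY ▸ extendY_vJp _ _ _
      · exact psi1_eq_extendY ▸ extendY_vJA _ _ _
      · exact psi1_vS c
      · fin_cases j
        · simp at hne
        · exact psi1_vEight
    · refine ⟨psi2, by simp [genFamily, psi2_vEight], ?_⟩
      rintro (p | p | c | j) hne -
      · exact psi2_eq_extendY ▸ extendY_vJp _ _ _
      · exact psi2_eq_extendY ▸ extendY_vJA _ _ _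
      · exact psi2_vS c
      · fin_cases j
        · exact psi2_vCircle
        · simp at hne

/-- The common kernel of `ψ₃, …, ψ₆`. -/
def psiKer : Submodule ℚ V :=
  LinearMap.ker psi3 ⊓ LinearMap.ker psi4 ⊓ LinearMap.ker psi5 ⊓ LinearMap.ker psi6

theorem mem_psiKer {v : V} :
    v ∈ psiKer ↔ psi3 v = 0 ∧ psi4 v = 0 ∧ psi5 v = 0 ∧ psi6 v = 0 := by
  simp [psiKer, and_assoc]

theorem span_genFamily_le_psiKer : Submodule.span ℚ (Set.range genFamily) ≤ psiKer := by
  rw [Submodule.span_le]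
  rintro _ ⟨p | p | a | i, rfl⟩ <;> rw [SetLike.mem_coe, mem_psiKer]
  · rw [psi3_eq_extendY, psi4_eq_extendY, psi5_eq_extendY, psi6_eq_extendY]
    exact ⟨extendY_vJp _ _ _, extendY_vJp _ _ _, extendY_vJp _ _ _, extendY_vJp _ _ _⟩
  · rw [psi3_eq_extendY, psi4_eq_extendY, psi5_eq_extendY, psi6_eq_extendY]
    exact ⟨extendY_vJA _ _ _, extendY_vJA _ _ _, extendY_vJA _ _ _, extendY_vJA _ _ _⟩
  · exact ⟨psi3_vS a, psi4_vS a, psi5_vS a, psi6_vS a⟩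
  · fin_cases i
    · simp [genFamily, vCircle, psi3, psi4, psi5, psi6]
    · simp [genFamily, vEight, psi3, psi4, psi5, psi6, ← Int.not_even_iff_odd]

theorem vJp_mem_span (a b : ℤ) : vJp a b ∈ Submodule.span ℚ (Set.range genFamily) := by
  rcases le_total b a with h | h
  · exact Submodule.subset_span ⟨Sum.inl ⟨(a, b), h⟩, rfl⟩
  · rw [vJp_comm]
    exact Submodule.subset_span ⟨Sum.inl ⟨(b, a), h⟩, rfl⟩

theorem vJA_mem_span (a b : ℤ) : vJA a b ∈ Submodule.span ℚ (Set.range genFamily) := by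
  rcases le_total b a with h | h
  · exact Submodule.subset_span ⟨Sum.inr (Sum.inl ⟨(a, b), h⟩), rfl⟩
  · rw [vJA_comm]
    exact Submodule.subset_span ⟨Sum.inr (Sum.inl ⟨(b, a), h⟩), rfl⟩

theorem vS_mem_span (a : ℤ) : vS a ∈ Submodule.span ℚ (Set.range genFamily) :=
  Submodule.subset_span ⟨Sum.inr (Sum.inr (Sum.inl a)), rfl⟩

theorem vCircle_mem_span : vCircle ∈ Submodule.span ℚ (Set.range genFamily) :=
  Submodule.subset_span ⟨Sum.inr (Sum.inr (Sum.inr 0)), rfl⟩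

theorem vEight_mem_span : vEight ∈ Submodule.span ℚ (Set.range genFamily) :=
  Submodule.subset_span ⟨Sum.inr (Sum.inr (Sum.inr 1)), rfl⟩

/-- The difference between `X_{a,b}` and the vector of `Y` congruent to it modulo the vectors
`vJp` and `vJA`. -/
def xRel (a b : ℤ) : V :=
  XB a b + YB (a + b) -
    (((a : ℚ) - b) / 2) • (YB (a + b - 2) - (2 : ℚ) • YB (a + b) + YB (a + b + 2))

theorem vJp_eq_xRel (a b : ℤ) : vJp a b = xRel a b + xRel b a := by
  simp only [vJp, xRel, add_comm b a]
  module

theorem vJA_eq_xRel (a b : ℤ) : vJA a b = xRel a (b + 1) + xRel b (a + 1) := by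
  have e1 : b + (a + 1) = a + b + 1 := by ring
  have e2 : a + (b + 1) = a + b + 1 := by ring
  have e3 : a + b + 1 - 2 = a + b - 1 := by ring
  have e4 : a + b + 1 + 2 = a + b + 3 := by ring
  simp only [vJA, xRel, e1, e2, e3, e4]
  push_cast
  module

theorem vS_eq_xRel (a : ℤ) : (2 : ℚ) • vS a =
    -((4 : ℚ) • xRel 0 (a + 1)) - (2 : ℚ) • xRel (-1) a + (2 : ℚ) • xRel 1 a
      + (4 : ℚ) • xRel 0 (a - 1)
      + (((a + 3 : ℤ) : ℚ) • YB (a + 3) - (3 * ((a + 1 : ℤ) : ℚ)) • YB (a + 1)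
        + (3 * ((a - 1 : ℤ) : ℚ)) • YB (a - 1) - ((a - 3 : ℤ) : ℚ) • YB (a - 3)) := by
  have e1 : -1 + a = a - 1 := by ring
  have e2 : 1 + a = a + 1 := by ring
  have e3 : a + 1 - 2 = a - 1 := by ring
  have e4 : a + 1 + 2 = a + 3 := by ring
  have e5 : a - 1 - 2 = a - 3 := by ring
  have e6 : a - 1 + 2 = a + 1 := by ring
  simp only [vS, xRel, zero_add, e1, e2, e3, e4, e5, e6]
  push_cast
  module

theorem xRel_mem_span (a b : ℤ) : xRel a b ∈ Submodule.span ℚ (Set.range genFamily) := by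
  set S := Submodule.span ℚ (Set.range genFamily)
  have hp : ∀ a b, xRel a b + xRel b a ∈ S := fun a b => vJp_eq_xRel a b ▸ vJp_mem_span a b
  have hA : ∀ a b, xRel a (b + 1) + xRel b (a + 1) ∈ S :=
    fun a b => vJA_eq_xRel a b ▸ vJA_mem_span a b
  have hstep : ∀ a b, xRel (a + 1) b - xRel a (b + 1) ∈ S := by
    intro a b
    convert S.sub_mem (hp (a + 1) b) (hA a b) using 1
    abel
  have hshift : ∀ n : ℤ, xRel (a + n) (b - n) - xRel a b ∈ S := by
    intro n
    induction n using Int.induction_on with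
    | zero => simp
    | succ i ih =>
      have h := S.add_mem (hstep (a + i) (b - i - 1)) ih
      rw [show b - (i : ℤ) - 1 + 1 = b - i by ring] at h
      rw [show a + ((i : ℤ) + 1) = a + i + 1 by ring,
        show b - ((i : ℤ) + 1) = b - i - 1 by ring]
      convert h using 1
      abel
    | pred i ih =>
      have h := S.sub_mem ih (hstep (a + (-i - 1)) (b - -i))
      rw [show a + (-(i : ℤ) - 1) + 1 = a + -i by ring] at h
      rw [show b - (-(i : ℤ) - 1) = b - -i + 1 by ring]
      convert h using 1
      abel
  have hswap := hshift (b - a)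
  rw [show a + (b - a) = b by ring, show b - (b - a) = a by ring] at hswap
  have h2 := S.smul_mem (1 / 2 : ℚ) (S.sub_mem (hp a b) hswap)
  convert h2 using 1
  module

theorem third_difference_YB_mem_span (a : ℤ) :
    ((a + 3 : ℤ) : ℚ) • YB (a + 3) - (3 * ((a + 1 : ℤ) : ℚ)) • YB (a + 1)
      + (3 * ((a - 1 : ℤ) : ℚ)) • YB (a - 1) - ((a - 3 : ℤ) : ℚ) • YB (a - 3)
      ∈ Submodule.span ℚ (Set.range genFamily) := by
  set S := Submodule.span ℚ (Set.range genFamily)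
  have h := S.sub_mem (S.smul_mem (2 : ℚ) (vS_mem_span a))
    (S.add_mem (S.add_mem (S.sub_mem (S.neg_mem (S.smul_mem (4 : ℚ) (xRel_mem_span 0 (a + 1))))
      (S.smul_mem (2 : ℚ) (xRel_mem_span (-1) a))) (S.smul_mem (2 : ℚ) (xRel_mem_span 1 a)))
      (S.smul_mem (4 : ℚ) (xRel_mem_span 0 (a - 1))))
  rw [vS_eq_xRel, add_sub_cancel_left] at h
  exact h

theorem odd_YB_mem_span (n : ℤ) :
    ((2 * n - 1 : ℤ) : ℚ) • YB (2 * n - 1)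
      - (YB 1 + ((((2 * n - 1 : ℤ) : ℚ) ^ 2 - 1) / 8) • ((3 : ℚ) • YB 3 - YB 1))
      ∈ Submodule.span ℚ (Set.range genFamily) := by
  refine mem_of_third_difference_mem _ (fun n : ℤ => ((2 * n - 1 : ℤ) : ℚ) • YB (2 * n - 1)
      - (YB 1 + ((((2 * n - 1 : ℤ) : ℚ) ^ 2 - 1) / 8) • ((3 : ℚ) • YB 3 - YB 1))) ?_ ?_ ?_ ?_ n
  · intro n
    convert third_difference_YB_mem_span (2 * n + 2) using 1
    rw [show 2 * (n + 3) - 1 = 2 * n + 2 + 3 by ring, show 2 * (n + 2) - 1 = 2 * n + 2 + 1 by ring,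
      show 2 * (n + 1) - 1 = 2 * n + 2 - 1 by ring, show 2 * n - 1 = 2 * n + 2 - 3 by ring]
    push_cast
    module
  · convert Submodule.neg_mem _ vCircle_mem_span using 1
    simp only [vCircle]
    norm_num
    abel
  · norm_num
  · norm_num

theorem even_YB_mem_span (n : ℤ) :
    ((2 * n - 2 : ℤ) : ℚ) • YB (2 * n - 2) - (((2 * n - 2 : ℤ) : ℚ) ^ 2 / 2) • YB 2
      ∈ Submodule.span ℚ (Set.range genFamily) := by
  refine mem_of_third_difference_mem _ (fun n : ℤ =>
    ((2 * n - 2 : ℤ) : ℚ) • YB (2 * n - 2) - (((2 * n - 2 : ℤ) : ℚ) ^ 2 / 2) • YB 2) ?_ ?_ ?_ ?_ n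
  · intro n
    convert third_difference_YB_mem_span (2 * n + 1) using 1
    rw [show 2 * (n + 3) - 2 = 2 * n + 1 + 3 by ring, show 2 * (n + 2) - 2 = 2 * n + 1 + 1 by ring,
      show 2 * (n + 1) - 2 = 2 * n + 1 - 1 by ring, show 2 * n - 2 = 2 * n + 1 - 3 by ring]
    push_cast
    module
  · convert Submodule.smul_mem _ (-2 : ℚ)
      (Submodule.sub_mem _ vEight_mem_span (xRel_mem_span 0 0)) using 1
    simp only [vEight, xRel]
    norm_num
    module
  · norm_num
  · norm_num

/-- Subtraction of the representative of a vector modulo the span of the generators. -/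
def residue : V →ₗ[ℚ] V :=
  LinearMap.id - psi5.smulRight (YB 1)
    - ((1 / 8 : ℚ) • (psi3 - psi5)).smulRight ((3 : ℚ) • YB 3 - YB 1)
    - ((1 / 2 : ℚ) • psi4).smulRight (YB 2) - psi6.smulRight (YB 0)

theorem residue_eq_self {v : V} (hv : v ∈ psiKer) : residue v = v := by
  obtain ⟨h3, h4, h5, h6⟩ := mem_psiKer.mp hv
  simp [residue, h3, h4, h5, h6]

theorem residue_YB_mem_span (d : ℤ) :
    residue (YB d) ∈ Submodule.span ℚ (Set.range genFamily) := by
  rcases eq_or_ne d 0 with rfl | hd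
  · convert Submodule.zero_mem _ using 1
    simp [residue, psi3, psi4, psi5, psi6]
  have hq : (d : ℚ) ≠ 0 := by exact_mod_cast hd
  rcases Int.even_or_odd d with h | h
  · obtain ⟨k, hk⟩ := h
    have hm := even_YB_mem_span (k + 1)
    rw [show 2 * (k + 1) - 2 = d by omega] at hm
    convert Submodule.smul_mem _ (1 / d : ℚ) hm using 1
    have hne : ¬ Odd d := by simp [hk]
    have he : Even d := ⟨k, hk⟩
    simp only [residue, psi3, psi4, psi5, psi6, LinearMap.sub_apply, LinearMap.smulRight_apply,
      LinearMap.smul_apply, LinearMap.id_apply, lmap_YB, hne, he, hd, if_true, if_false]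
    match_scalars <;> field_simp <;> simp
  · obtain ⟨k, hk⟩ := id h
    have hm := odd_YB_mem_span (k + 1)
    rw [show 2 * (k + 1) - 1 = d by omega] at hm
    convert Submodule.smul_mem _ (1 / d : ℚ) hm using 1
    have hne : ¬ Even d := by simpa using h
    simp only [residue, psi3, psi4, psi5, psi6, LinearMap.sub_apply, LinearMap.smulRight_apply,
      LinearMap.smul_apply, LinearMap.id_apply, lmap_YB, hne, h, hd, if_true, if_false]
    match_scalars <;> simp <;> field_simp <;> ring

theorem residue_XB_mem_span (a b : ℤ) :
    residue (XB a b) ∈ Submodule.span ℚ (Set.range genFamily) := by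
  set S := Submodule.span ℚ (Set.range genFamily)
  have hx : XB a b = xRel a b - YB (a + b) +
      (((a : ℚ) - b) / 2) • (YB (a + b - 2) - (2 : ℚ) • YB (a + b) + YB (a + b + 2)) := by
    rw [xRel]
    abel
  rw [hx]
  simp only [map_add, map_sub, map_smul,
    residue_eq_self (span_genFamily_le_psiKer (xRel_mem_span a b))]
  exact S.add_mem (S.sub_mem (xRel_mem_span a b) (residue_YB_mem_span _))
    (S.smul_mem _ (S.add_mem (S.sub_mem (residue_YB_mem_span _)
      (S.smul_mem _ (residue_YB_mem_span _))) (residue_YB_mem_span _)))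

theorem residue_mem_span (v : V) : residue v ∈ Submodule.span ℚ (Set.range genFamily) := by
  have hv : v ∈ Submodule.span ℚ (Set.range (fun p : ℤ × ℤ => XB p.1 p.2) ∪ Set.range YB) :=
    span_XB_YB_eq_top ▸ Submodule.mem_top
  rw [← Submodule.mem_comap]
  refine Submodule.span_le.mpr ?_ hv
  rintro _ (⟨p, rfl⟩ | ⟨d, rfl⟩)
  · exact residue_XB_mem_span _ _
  · exact residue_YB_mem_span d

theorem span_genFamily : Submodule.span ℚ (Set.range genFamily) = psiKer :=
  le_antisymm span_genFamily_le_psiKer fun v hv => residue_eq_self hv ▸ residue_mem_span v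

theorem stmt18 :
    LinearIndependent ℚ
      (Sum.elim (fun p : {p : ℤ × ℤ // p.2 ≤ p.1} => vJp p.1.1 p.1.2)
        (Sum.elim (fun p : {p : ℤ × ℤ // p.2 ≤ p.1} => vJA p.1.1 p.1.2)
          (Sum.elim vS
            ![YB (-1) + YB 1, XB 0 0 + YB (-2) + YB 0 + YB 2]))) ∧
    (Submodule.span ℚ
      (Set.range (Sum.elim (fun p : {p : ℤ × ℤ // p.2 ≤ p.1} => vJp p.1.1 p.1.2)
        (Sum.elim (fun p : {p : ℤ × ℤ // p.2 ≤ p.1} => vJA p.1.1 p.1.2)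
          (Sum.elim vS
            ![YB (-1) + YB 1, XB 0 0 + YB (-2) + YB 0 + YB 2])))) : Set V) =
      {v : V | psi3 v = 0 ∧ psi4 v = 0 ∧ psi5 v = 0 ∧ psi6 v = 0} := by
  refine ⟨linearIndependent_genFamily, ?_⟩
  ext v
  exact (SetLike.ext_iff.mp span_genFamily v).trans mem_psiKer
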